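/- arXiv:1710.07456 — 2 statements merged into one kernel-verified Lean document; each statement's English description precedes it below -/
import Mathlib

section
/- A monomial ideal I ⊆ k[x_P] equals Λ̄(J^c) for some poset ideal J ⊆ Hom(P,ℕ) (meaning the monomials lying in I are exactly {Λ̄ψ : ψ ∈ J^c}) if and only if I is P-stable. -/
open MvPolynomial
open scoped Classical

/-- The ascent of an isotone map `φ : P → ℕ`:
`Λφ = {(p,i) : i < φ(p) and φ(q) ≤ i for all q < p}`. -/
def ascent {P : Type*} [PartialOrder P] (φ : P →o ℕ) : Set (P × ℕ) :=
  {x | x.2 < φ x.1 ∧ ∀ q < x.1, φ q ≤ x.2}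

/-- The graph of an isotone map `φ : P → ℕ`: `Γφ = {(p,i) : φ(p) = i}`. -/
def graphOf {P : Type*} [PartialOrder P] (φ : P →o ℕ) : Set (P × ℕ) :=
  {x | φ x.1 = x.2}

/-- A poset ideal: a downward closed subset of a poset. -/
def IsPosetIdeal {Q : Type*} [Preorder Q] (I : Set Q) : Prop :=
  ∀ q ∈ I, ∀ q' ≤ q, q' ∈ I

/-- A marker for a poset ideal `J ⊆ Hom(P,ℕ)`: a poset ideal `I ⊆ P` together with an
isotone map `α : I → ℕ` such that every isotone `φ : P → ℕ` restricting to `α` on `I`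
lies in `J`. -/
def IsMarker {P : Type*} [PartialOrder P] (J : Set (P →o ℕ)) (I : Set P) (α : I → ℕ) : Prop :=
  IsPosetIdeal I ∧ Monotone α ∧ ∀ φ : P →o ℕ, (∀ p : I, φ p = α p) → φ ∈ J

/-- A minimal marker: no restriction to a properly contained poset ideal is a marker. -/
def IsMinimalMarker {P : Type*} [PartialOrder P] (J : Set (P →o ℕ)) (I : Set P)
    (α : I → ℕ) : Prop :=
  IsMarker J I α ∧ ∀ (I' : Set P) (h : I' ⊆ I), I' ≠ I →
    ¬ IsMarker J I' (fun p => α ⟨p.1, h p.2⟩)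

/-- The graph of a marker `α : I → ℕ`. -/
def markerGraph {P : Type*} [PartialOrder P] (I : Set P) (α : I → ℕ) : Set (P × ℕ) :=
  Set.range fun p : I => ((p : P), α p)

lemma ascent_finite {P : Type*} [PartialOrder P] [Fintype P] (φ : P →o ℕ) :
    (ascent φ).Finite := by
  apply Set.Finite.subset
    ((Set.finite_univ (α := P)).prod (Set.finite_Iio (Finset.univ.sup (fun p => φ p) + 1)))
  rintro ⟨p, i⟩ hpi
  exact ⟨trivial, (lt_of_lt_of_le hpi.1 (Finset.le_sup (Finset.mem_univ p))).trans
    (Nat.lt_succ_self _)⟩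

/-- `Λ̄φ : P → ℕ`, the multiplicity function of the ascent under projection to `P`. -/
noncomputable def lambdaBar {P : Type*} [PartialOrder P] (φ : P →o ℕ) : P → ℕ :=
  fun p => {i : ℕ | (p, i) ∈ ascent φ}.ncard
/-- A `b`-chain of length `r` in a monomial `m` (given by its exponent function
`m : P → ℕ`): a multichain `c 0 ≤ ⋯ ≤ c (r-1)` in `P` with all members `≤ b`, such
that `∏ x_{c i}` divides `m`. -/
def IsBChain {P : Type*} [PartialOrder P] (m : P → ℕ) (b : P) (r : ℕ)
    (c : Fin r → P) : Prop :=
  Monotone c ∧ (∀ i, c i ≤ b) ∧ ∀ p : P, {i | c i = p}.ncard ≤ m p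
/-- A longest `b`-chain in `m`: a `b`-chain in `m` such that no `b`-chain in `m`
is longer. -/
def IsLongestBChain {P : Type*} [PartialOrder P] (m : P → ℕ) (b : P) (r : ℕ)
    (c : Fin r → P) : Prop :=
  IsBChain m b r c ∧ ∀ (r' : ℕ) (c' : Fin r' → P), IsBChain m b r' c' → r' ≤ r

/-- `a` may be inserted into the multichain `c` to make it a larger multichain
(`a` may coincide with some member of `c`). -/
def InsertedThrough {P : Type*} [PartialOrder P] (a : P) {r : ℕ} (c : Fin r → P) : Prop :=
  ∃ (c' : Fin (r + 1) → P) (j : Fin (r + 1)), Monotone c' ∧ c' j = a ∧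
    c = c' ∘ j.succAbove

/-- A monomial ideal: an ideal generated by the monomials belonging to it. -/
def IsMonomialIdeal (k : Type*) [Field k] {σ : Type*} (I : Ideal (MvPolynomial σ k)) :
    Prop :=
  I = Ideal.span {f | ∃ d : σ →₀ ℕ, f = monomial d (1 : k) ∧ f ∈ I}

/-- A monomial ideal `I ⊆ k[x_P]` is `P`-stable if: whenever `m = n·∏_{b∈B} x_b ∈ I`
with `B ⊆ P` an antichain, and `a ∈ P` is such that for every `b ∈ B` some longest
`b`-chain in `m` goes through `a`, then `n·x_a ∈ I`. -/
def PStable (k : Type*) [Field k] {P : Type*} [PartialOrder P] [Fintype P]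
    (I : Ideal (MvPolynomial P k)) : Prop :=
  ∀ (n : P →₀ ℕ) (B : Finset P) (a : P),
    IsAntichain (· ≤ ·) (B : Set P) →
    monomial (n + ∑ b ∈ B, Finsupp.single b 1) (1 : k) ∈ I →
    (∀ b ∈ B, a ≤ b ∧ ∃ (r : ℕ) (c : Fin r → P),
      IsLongestBChain (fun p => (n + ∑ b ∈ B, Finsupp.single b 1 : P →₀ ℕ) p) b r c ∧ InsertedThrough a c) →
    monomial (n + Finsupp.single a 1) (1 : k) ∈ I
/-- The supremum of `f` over the elements strictly below `p`. -/
noncomputable def supBelow {P : Type*} [PartialOrder P] [Fintype P] (f : P → ℕ) (p : P) : ℕ :=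
  (Finset.univ.filter (· < p)).sup f

lemma le_supBelow {P : Type*} [PartialOrder P] [Fintype P] (f : P → ℕ) {p q : P} (h : q < p) :
    f q ≤ supBelow f p :=
  Finset.le_sup (f := f) (by simpa using h)

lemma supBelow_le {P : Type*} [PartialOrder P] [Fintype P] {f : P → ℕ} {p : P} {t : ℕ}
    (h : ∀ q < p, f q ≤ t) : supBelow f p ≤ t :=
  Finset.sup_le fun q hq => h q (by simpa using hq)

lemma supBelow_mono {P : Type*} [PartialOrder P] [Fintype P] {f g : P → ℕ} {p : P}
    (h : ∀ q < p, f q ≤ g q) : supBelow f p ≤ supBelow g p :=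
  supBelow_le fun q hq => (h q hq).trans (le_supBelow g hq)

lemma supBelow_congr {P : Type*} [PartialOrder P] [Fintype P] {f g : P → ℕ} {p : P}
    (h : ∀ q < p, f q = g q) : supBelow f p = supBelow g p :=
  le_antisymm (supBelow_mono fun q hq => (h q hq).le) (supBelow_mono fun q hq => (h q hq).ge)

/-- The largest weight of a chain below `b`, where `p` has weight `m p`. -/
noncomputable def chainWeight {P : Type*} [PartialOrder P] [Fintype P] (m : P → ℕ) (b : P) : ℕ :=
  m b + Finset.univ.sup fun q : {q : P // q < b} => chainWeight m q.1
termination_by wellFounded_lt.wrap b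
decreasing_by exact q.2

lemma chainWeight_eq {P : Type*} [PartialOrder P] [Fintype P] (m : P → ℕ) (b : P) :
    chainWeight m b = m b + supBelow (chainWeight m) b := by
  rw [chainWeight]
  congr 1
  apply le_antisymm
  · exact Finset.sup_le fun q _ => le_supBelow (chainWeight m) q.2
  · exact supBelow_le fun q hq =>
      Finset.le_sup (f := fun q : {q : P // q < b} => chainWeight m q.1)
        (Finset.mem_univ (⟨q, hq⟩ : {q : P // q < b}))

lemma add_chainWeight_le {P : Type*} [PartialOrder P] [Fintype P] (m : P → ℕ) {q b : P}
    (h : q < b) : m b + chainWeight m q ≤ chainWeight m b := by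
  rw [chainWeight_eq m b]
  exact Nat.add_le_add_left (le_supBelow _ h) _

lemma chainWeight_monotone {P : Type*} [PartialOrder P] [Fintype P] (m : P → ℕ) :
    Monotone (chainWeight m) := by
  intro p q h
  rcases h.eq_or_lt with rfl | h
  · exact le_rfl
  · exact le_of_add_le_right (add_chainWeight_le m h)

lemma chainWeight_le_of_le_below {P : Type*} [PartialOrder P] [Fintype P] {m m' : P → ℕ} (b : P) :
    (∀ p ≤ b, m p ≤ m' p) → chainWeight m b ≤ chainWeight m' b := by
  induction b using WellFoundedLT.induction with
  | ind b ih =>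
    intro h
    rw [chainWeight_eq m, chainWeight_eq m']
    exact add_le_add (h b le_rfl)
      (supBelow_mono fun q hq => ih q hq fun p hp => h p (hp.trans hq.le))

/-- The isotone map `b ↦ chainWeight m b`. -/
noncomputable def chainWeightHom {P : Type*} [PartialOrder P] [Fintype P] (m : P → ℕ) : P →o ℕ :=
  ⟨chainWeight m, chainWeight_monotone m⟩

lemma lambdaBar_add_supBelow {P : Type*} [PartialOrder P] [Fintype P] (φ : P →o ℕ) (p : P) :
    lambdaBar φ p + supBelow φ p = φ p := by
  have hset : {i : ℕ | (p, i) ∈ ascent φ} = ↑(Finset.Ico (supBelow φ p) (φ p)) := by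
    ext i
    simp only [ascent, Set.mem_ofPred_eq, Finset.coe_Ico, Set.mem_Ico]
    exact ⟨fun h => ⟨supBelow_le h.2, h.1⟩, fun h => ⟨h.2, fun q hq => (le_supBelow φ hq).trans h.1⟩⟩
  have hle : supBelow φ p ≤ φ p := supBelow_le fun q hq => φ.monotone hq.le
  rw [lambdaBar, hset, Set.ncard_coe_finset, Nat.card_Ico]
  omega

lemma chainWeight_lambdaBar {P : Type*} [PartialOrder P] [Fintype P] (φ : P →o ℕ) (p : P) :
    chainWeight (lambdaBar φ) p = φ p := by
  induction p using WellFoundedLT.induction with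
  | ind p ih => rw [chainWeight_eq, supBelow_congr ih, lambdaBar_add_supBelow]

lemma lambdaBar_chainWeightHom {P : Type*} [PartialOrder P] [Fintype P] (m : P → ℕ) :
    lambdaBar (chainWeightHom m) = m := by
  funext p
  have h := lambdaBar_add_supBelow (chainWeightHom m) p
  have h' := chainWeight_eq m p
  change _ + supBelow (chainWeight m) p = chainWeight m p at h
  omega

lemma IsBChain.length_le {P : Type*} [PartialOrder P] [Fintype P] {m : P → ℕ} (b : P) :
    ∀ {r : ℕ} {c : Fin r → P}, IsBChain m b r c → r ≤ chainWeight m b := by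
  induction b using WellFoundedLT.induction with
  | ind b ih =>
    intro r c ⟨hmono, hle, hmult⟩
    set N := {i | c i = b}.ncard with hN
    have hNr : N ≤ r := by
      simpa using Set.ncard_le_card {i | c i = b}
    have hNm : N ≤ m b := hmult b
    rcases Nat.eq_zero_or_pos (r - N) with h0 | hpos
    · have := chainWeight_eq m b
      omega
    · have hlt : r - N - 1 < r := by omega
      have hne : c ⟨r - N - 1, hlt⟩ ≠ b := by
        intro heq
        have hsub : ((Finset.Ici (⟨r - N - 1, hlt⟩ : Fin r) : Finset (Fin r)) : Set (Fin r)) ⊆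
            {i | c i = b} := by
          intro i hi
          exact le_antisymm (hle i) (heq ▸ hmono (by simpa using hi))
        have := Set.ncard_le_ncard hsub (Set.toFinite _)
        rw [Set.ncard_coe_finset, Fin.card_Ici] at this
        simp only at this
        omega
      have hq : c ⟨r - N - 1, hlt⟩ < b := lt_of_le_of_ne (hle _) hne
      have hchain : IsBChain m (c ⟨r - N - 1, hlt⟩) (r - N)
          (c ∘ Fin.castLE (Nat.sub_le r N)) := by
        refine ⟨hmono.comp (Fin.strictMono_castLE _).monotone, fun i => hmono ?_, fun p => ?_⟩
        · rw [Fin.le_def]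
          simp only [Fin.val_castLE]
          omega
        · refine le_trans ?_ (hmult p)
          exact Set.ncard_le_ncard_of_injOn (Fin.castLE (Nat.sub_le r N)) (fun i hi => hi)
            (Fin.castLE_injective _).injOn (Set.toFinite _)
      have h1 := ih _ hq hchain
      have h2 := add_chainWeight_le m hq
      omega

/-- Prolong a sequence by copies of `b`. -/
def extendBy {P : Type*} {s : ℕ} (c : Fin s → P) (b : P) (t : ℕ) : Fin (s + t) → P :=
  fun i => if h : i.1 < s then c ⟨i.1, h⟩ else b

lemma extendBy_monotone {P : Type*} [PartialOrder P] {s : ℕ} {c : Fin s → P} (hc : Monotone c)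
    {b : P} (hb : ∀ i, c i ≤ b) (t : ℕ) : Monotone (extendBy c b t) := by
  intro i j hij
  rw [Fin.le_def] at hij
  unfold extendBy
  split_ifs with h1 h2 h2
  · exact hc hij
  · exact hb _
  · omega
  · exact le_rfl

lemma isBChain_extendBy {P : Type*} [PartialOrder P] {m : P → ℕ} {s : ℕ} {c : Fin s → P}
    (hc : Monotone c) {b : P} (hb : ∀ i, c i < b) (hm : ∀ p, {i | c i = p}.ncard ≤ m p) :
    IsBChain m b (s + m b) (extendBy c b (m b)) := by
  refine ⟨extendBy_monotone hc (fun i => (hb i).le) _, fun i => ?_, fun p => ?_⟩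
  · unfold extendBy
    split_ifs
    · exact (hb _).le
    · exact le_rfl
  · by_cases hp : p = b
    · subst hp
      have hsub : {i | extendBy c p (m p) i = p} ⊆ Set.range (Fin.natAdd s) := by
        intro i hi
        have his : s ≤ i.1 := by
          by_contra hlt
          rw [not_le] at hlt
          simp only [extendBy, Set.mem_ofPred_eq, hlt, dite_true] at hi
          exact (hb _).ne hi
        exact ⟨⟨i.1 - s, by omega⟩, Fin.ext (by simp; omega)⟩
      refine (Set.ncard_le_ncard hsub (Set.toFinite _)).trans ?_
      rw [← Set.image_univ]
      refine (Set.ncard_image_le (Set.toFinite _)).trans ?_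
      simp
    · have hsub : {i | extendBy c b (m b) i = p} ⊆ Fin.castAdd (m b) '' {i | c i = p} := by
        intro i hi
        simp only [extendBy, Set.mem_ofPred_eq] at hi
        split_ifs at hi with h
        · exact ⟨⟨i.1, h⟩, hi, rfl⟩
        · exact absurd hi.symm hp
      exact ((Set.ncard_le_ncard hsub (Set.toFinite _)).trans
        (Set.ncard_image_le (Set.toFinite _))).trans (hm p)

lemma exists_isBChain_chainWeight {P : Type*} [PartialOrder P] [Fintype P] (m : P → ℕ) (b : P) :
    ∃ c : Fin (chainWeight m b) → P, IsBChain m b (chainWeight m b) c := by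
  induction b using WellFoundedLT.induction with
  | ind b ih =>
    rcases (Finset.univ.filter (· < b)).eq_empty_or_nonempty with he | hne
    · have h : chainWeight m b = 0 + m b := by
        rw [chainWeight_eq, supBelow, he]
        simp
      rw [h]
      exact ⟨_, isBChain_extendBy (c := (Fin.elim0 : Fin 0 → P)) (fun i => i.elim0)
        (fun i => i.elim0) (fun p => by simp [Set.eq_empty_of_isEmpty])⟩
    · obtain ⟨q, hq, hsup⟩ := Finset.exists_mem_eq_sup _ hne (chainWeight m)
      have hqb : q < b := by simpa using hq
      obtain ⟨c, h1, h2, h3⟩ := ih q hqb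
      have h : chainWeight m b = chainWeight m q + m b := by
        rw [chainWeight_eq m b, supBelow, hsup, add_comm]
      rw [h]
      exact ⟨_, isBChain_extendBy h1 (fun i => (h2 i).trans_lt hqb) h3⟩

lemma IsLongestBChain.length_eq {P : Type*} [PartialOrder P] [Fintype P] {m : P → ℕ} {b : P}
    {r : ℕ} {c : Fin r → P} (h : IsLongestBChain m b r c) : r = chainWeight m b := by
  obtain ⟨c', hc'⟩ := exists_isBChain_chainWeight m b
  exact le_antisymm (IsBChain.length_le b h.1) (h.2 _ c' hc')

lemma exists_isLongestBChain_through {P : Type*} [PartialOrder P] [Fintype P] {m : P → ℕ} {a b : P}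
    (hab : a < b) (h : chainWeight m b = chainWeight m a + m b) :
    ∃ (r : ℕ) (c : Fin r → P), IsLongestBChain m b r c ∧ InsertedThrough a c := by
  obtain ⟨c, h1, h2, h3⟩ := exists_isBChain_chainWeight m a
  refine ⟨_, _, ⟨isBChain_extendBy h1 (fun i => (h2 i).trans_lt hab) h3,
    fun r' c' hc' => h ▸ IsBChain.length_le b hc'⟩, ?_⟩
  have hmono : Monotone (extendBy c a 1) := extendBy_monotone h1 h2 1
  have hle : ∀ i, extendBy c a 1 i ≤ b := by
    intro i
    unfold extendBy
    split_ifs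
    · exact (h2 _).trans hab.le
    · exact hab.le
  refine ⟨extendBy (extendBy c a 1) b (m b) ∘ Fin.cast (by omega),
    ⟨chainWeight m a, by omega⟩, ?_, ?_, ?_⟩
  · exact (extendBy_monotone hmono hle _).comp fun i j hij => hij
  · simp [extendBy]
  · funext i
    by_cases hi : i.1 < chainWeight m a
    · have hs : (Fin.succAbove (⟨chainWeight m a, by omega⟩ : Fin (chainWeight m a + m b + 1)) i).1
          = i.1 := by
        rw [Fin.succAbove_of_castSucc_lt _ _ (by rw [Fin.lt_def]; exact hi)]
        rfl
      have hi' : i.1 < chainWeight m a + 1 := by omega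
      simp [extendBy, hs, hi, hi']
    · have hs : (Fin.succAbove (⟨chainWeight m a, by omega⟩ : Fin (chainWeight m a + m b + 1)) i).1
          = i.1 + 1 := by
        rw [Fin.succAbove_of_le_castSucc _ _ (by rw [Fin.le_def]; exact not_lt.mp hi)]
        rfl
      have hi' : ¬ i.1 + 1 < chainWeight m a + 1 := by omega
      simp [extendBy, hs, hi]

lemma IsBChain.succ_length_le_of_insertedThrough {P : Type*} [PartialOrder P] [Fintype P]
    {m : P → ℕ} {a b : P} {r : ℕ} {c : Fin r → P} (hab : a ≤ b) (hc : IsBChain m b r c)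
    (h : InsertedThrough a c) : r + 1 ≤ chainWeight (fun p => m p + if p = a then 1 else 0) b := by
  obtain ⟨c', j, hmono, hj, rfl⟩ := h
  obtain ⟨-, hle, hmult⟩ := hc
  refine IsBChain.length_le b (c := c') ⟨hmono, fun i => ?_, fun p => ?_⟩
  · rcases Fin.eq_self_or_eq_succAbove j i with rfl | ⟨i, rfl⟩
    · exact hj ▸ hab
    · exact hle i
  · by_cases hp : p = a
    · have hsub : {i | c' i = p} ⊆ insert j (j.succAbove '' {i | (c' ∘ j.succAbove) i = p}) := by
        intro i hi
        rcases Fin.eq_self_or_eq_succAbove j i with rfl | ⟨i, rfl⟩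
        · exact Set.mem_insert _ _
        · exact Set.mem_insert_of_mem _ ⟨i, hi, rfl⟩
      simp only [if_pos hp]
      refine (Set.ncard_le_ncard hsub (Set.toFinite _)).trans ((Set.ncard_insert_le _ _).trans ?_)
      exact Nat.add_le_add_right ((Set.ncard_image_le (Set.toFinite _)).trans (hmult p)) 1
    · have hsub : {i | c' i = p} ⊆ j.succAbove '' {i | (c' ∘ j.succAbove) i = p} := by
        intro i hi
        rcases Fin.eq_self_or_eq_succAbove j i with rfl | ⟨i, rfl⟩
        · exact absurd (hi.symm.trans hj) hp
        · exact ⟨i, hi, rfl⟩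
      simp only [if_neg hp]
      exact (Set.ncard_le_ncard hsub (Set.toFinite _)).trans
        ((Set.ncard_image_le (Set.toFinite _)).trans (hmult p))

lemma sum_single_one_apply {P : Type*} (B : Finset P) (p : P) :
    (∑ b ∈ B, Finsupp.single b 1 : P →₀ ℕ) p = if p ∈ B then 1 else 0 := by
  simp [Finsupp.finsetSum_apply, Finsupp.single_apply]

lemma chainWeight_le_of_exchange {P : Type*} [PartialOrder P] [Fintype P] {n : P →₀ ℕ}
    {B : Finset P} {a : P} (hB : IsAntichain (· ≤ ·) (B : Set P))
    (h : ∀ b ∈ B, a ≤ b ∧ ∃ (r : ℕ) (c : Fin r → P),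
      IsLongestBChain (fun p => (n + ∑ b ∈ B, Finsupp.single b 1 : P →₀ ℕ) p) b r c ∧
        InsertedThrough a c) (p : P) :
    chainWeight (n + ∑ b ∈ B, Finsupp.single b 1 : P →₀ ℕ) p ≤
      chainWeight (n + Finsupp.single a 1 : P →₀ ℕ) p := by
  induction p using WellFoundedLT.induction with
  | ind p ih =>
    by_cases hp : p ∈ B
    · obtain ⟨hap, r, c, hc, hac⟩ := h p hp
      have hr : r = chainWeight (n + ∑ b ∈ B, Finsupp.single b 1 : P →₀ ℕ) p := hc.length_eq
      have h1 := IsBChain.succ_length_le_of_insertedThrough hap hc.1 hac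
      have h2 := h1.trans (chainWeight_le_of_le_below
        (m' := fun q => (n + Finsupp.single a 1 : P →₀ ℕ) q + if q = p then 1 else 0) p ?_)
      · rw [chainWeight_eq, if_pos rfl] at h2
        have h3 := chainWeight_eq (n + Finsupp.single a 1 : P →₀ ℕ) p
        have h4 : supBelow (chainWeight fun q =>
            (n + Finsupp.single a 1 : P →₀ ℕ) q + if q = p then 1 else 0) p ≤
            supBelow (chainWeight (n + Finsupp.single a 1 : P →₀ ℕ)) p := by
          refine supBelow_mono fun q hq => chainWeight_le_of_le_below q fun s hs => ?_
          rw [if_neg (hs.trans_lt hq).ne, add_zero]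
        omega
      · intro q hq
        have hqB : q ∈ B → q = p := fun hqB => hB.eq hqB hp hq
        simp only [Finsupp.add_apply, sum_single_one_apply, Finsupp.single_apply, eq_comm (a := a)]
        split_ifs <;> first | omega | tauto
    · rw [chainWeight_eq, chainWeight_eq (n + Finsupp.single a 1 : P →₀ ℕ)]
      refine add_le_add ?_ (supBelow_mono ih)
      rw [Finsupp.add_apply, sum_single_one_apply, if_neg hp, Finsupp.add_apply]
      omega

/-- The exponent vector of `Λ̄φ`. -/
noncomputable def ascentExponent {P : Type*} [PartialOrder P] [Fintype P] (φ : P →o ℕ) : P →₀ ℕ :=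
  Finsupp.equivFunOnFinite.symm (lambdaBar φ)

lemma PStable.mem_of_increment {k : Type*} [Field k] {P : Type*} [PartialOrder P] [Fintype P]
    {I : Ideal (MvPolynomial P k)} (hI : PStable k I) {φ φ' : P →o ℕ} {a : P}
    (h : ∀ q, φ' q = φ q + if q = a then 1 else 0)
    (hφ : monomial (ascentExponent φ) (1 : k) ∈ I) :
    monomial (ascentExponent φ') (1 : k) ∈ I := by
  have ha' : φ' a = φ a + 1 := by simp [h]
  have hne' : ∀ q, q ≠ a → φ' q = φ q := fun q hq => by simp [h, hq]
  have hlt : ∀ q, a < q → φ a < φ q := by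
    intro q hq
    have := φ'.monotone hq.le
    rw [ha', hne' q hq.ne'] at this
    omega
  set B : Finset P := Finset.univ.filter fun b => a < b ∧ ∀ q < b, φ q ≤ φ a with hBdef
  have hmem : ∀ b, b ∈ B ↔ a < b ∧ ∀ q < b, φ q ≤ φ a := by simp [hBdef]
  have hsupB : ∀ b ∈ B, supBelow φ b = φ a := fun b hb =>
    le_antisymm (supBelow_le ((hmem b).1 hb).2) (le_supBelow φ ((hmem b).1 hb).1)
  have hval : ∀ p, lambdaBar φ' p + (if p ∈ B then 1 else 0) =
      lambdaBar φ p + if p = a then 1 else 0 := by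
    intro p
    have e1 := lambdaBar_add_supBelow φ p
    have e2 := lambdaBar_add_supBelow φ' p
    have e3 := h p
    by_cases hp : p ∈ B
    · have hap := ((hmem p).1 hp).1
      have e4 : supBelow φ' p = φ a + 1 := by
        refine le_antisymm (supBelow_le fun q hq => ?_) (ha' ▸ le_supBelow φ' hap)
        have := ((hmem p).1 hp).2 q hq
        rw [h q]
        split_ifs <;> omega
      have e5 := hsupB p hp
      rw [if_neg hap.ne'] at e3 ⊢
      rw [if_pos hp]
      omega
    · have e4 : supBelow φ' p = supBelow φ p := by
        refine le_antisymm (supBelow_le fun q hq => ?_) (supBelow_mono fun q _ => by rw [h q]; omega)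
        by_cases hqa : q = a
        · subst hqa
          have : ∃ s < p, φ q < φ s := by
            by_contra! hcon
            exact hp ((hmem p).2 ⟨hq, hcon⟩)
          obtain ⟨s, hs, hs'⟩ := this
          rw [ha']
          exact hs'.trans_le (le_supBelow φ hs)
        · rw [hne' q hqa]
          exact le_supBelow φ hq
      rw [if_neg hp]
      omega
  have hBanti : IsAntichain (· ≤ ·) (B : Set P) := by
    intro b hb b' hb' hne hle
    have h1 := ((hmem b').1 hb').2 b (lt_of_le_of_ne hle hne)
    have h2 := hlt b ((hmem b).1 hb).1
    omega
  have haB : a ∉ B := fun haB => lt_irrefl a ((hmem a).1 haB).1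
  have hsum : ascentExponent φ - ∑ b ∈ B, Finsupp.single b 1 + ∑ b ∈ B, Finsupp.single b 1 =
      ascentExponent φ := by
    refine tsub_add_cancel_of_le fun p => ?_
    rw [sum_single_one_apply]
    change _ ≤ lambdaBar φ p
    have := hval p
    split_ifs at this ⊢ with h1 h2
    · exact absurd (h2 ▸ h1) haB
    all_goals omega
  have hres := hI (ascentExponent φ - ∑ b ∈ B, Finsupp.single b 1) B a hBanti
    (by rw [hsum]; exact hφ) (fun b hb => ⟨((hmem b).1 hb).1.le, ?_⟩)
  · suffices heq : ascentExponent φ' =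
        ascentExponent φ - ∑ b ∈ B, Finsupp.single b 1 + Finsupp.single a 1 from heq ▸ hres
    ext p
    rw [Finsupp.add_apply, Finsupp.tsub_apply, sum_single_one_apply, Finsupp.single_apply]
    change lambdaBar φ' p = lambdaBar φ p - _ + _
    have := hval p
    simp only [eq_comm (a := a)]
    by_cases hpa : p = a
    · have hpB : p ∉ B := hpa ▸ haB
      simp only [hpa, haB, if_true, if_false] at this ⊢
      omega
    · simp only [hpa, if_false] at this ⊢
      omega
  · rw [hsum]
    refine exists_isLongestBChain_through (m := lambdaBar φ) ((hmem b).1 hb).1 ?_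
    rw [chainWeight_lambdaBar, chainWeight_lambdaBar, ← lambdaBar_add_supBelow φ b, hsupB b hb,
      add_comm]

lemma OrderHom.exists_increment_le {P : Type*} [PartialOrder P] [Fintype P] {φ ψ : P →o ℕ}
    (h : φ ≤ ψ) (hne : φ ≠ ψ) :
    ∃ (φ' : P →o ℕ) (a : P), (∀ q, φ' q = φ q + if q = a then 1 else 0) ∧ φ' ≤ ψ := by
  have hS : (Finset.univ.filter fun p => φ p < ψ p).Nonempty := by
    by_contra hcon
    rw [Finset.not_nonempty_iff_eq_empty, Finset.filter_eq_empty_iff] at hcon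
    exact hne (OrderHom.ext _ _ (funext fun p =>
      le_antisymm (h p) (not_lt.1 (hcon (Finset.mem_univ p)))))
  obtain ⟨a, ha⟩ := Finset.exists_maximal hS
  have haψ : φ a < ψ a := by simpa using ha.prop
  have heq : ∀ q, a < q → φ q = ψ q := by
    intro q hq
    refine le_antisymm (h q) (not_lt.1 fun hlt => ?_)
    exact hq.not_ge (ha.le_of_ge (by simpa using hlt) hq.le)
  refine ⟨⟨fun q => φ q + if q = a then 1 else 0, fun p q hpq => ?_⟩, a, fun q => rfl, fun q => ?_⟩
  · have h1 := φ.monotone hpq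
    by_cases hp : p = a
    · subst hp
      rcases hpq.eq_or_lt with rfl | hlt
      · exact le_rfl
      · have h2 := heq q hlt
        have h3 := ψ.monotone hpq
        simp only [if_true]
        omega
    · simp only [hp, if_false]
      omega
  · have h1 := h q
    change φ q + (if q = a then 1 else 0) ≤ ψ q
    split_ifs with hq
    · subst hq
      exact haψ
    · exact h1

lemma PStable.mem_of_le {k : Type*} [Field k] {P : Type*} [PartialOrder P] [Fintype P]
    {I : Ideal (MvPolynomial P k)} (hI : PStable k I) {φ ψ : P →o ℕ} (h : φ ≤ ψ)
    (hφ : monomial (ascentExponent φ) (1 : k) ∈ I) :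
    monomial (ascentExponent ψ) (1 : k) ∈ I := by
  induction hN : ∑ p, (ψ p - φ p) using Nat.strong_induction_on generalizing φ with
  | _ N ih =>
    by_cases hne : φ = ψ
    · exact hne ▸ hφ
    · obtain ⟨φ', a, hinc, hle⟩ := OrderHom.exists_increment_le h hne
      refine ih _ ?_ hle (hI.mem_of_increment hinc hφ) rfl
      rw [← hN]
      refine Finset.sum_lt_sum (fun p _ => ?_) ⟨a, Finset.mem_univ a, ?_⟩
      · rw [hinc p]
        omega
      · have h1 := hle a
        have h2 := hinc a
        rw [if_pos rfl] at h2
        change φ' a ≤ ψ a at h1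
        omega

/-- A monomial ideal `I ⊆ k[x_P]` equals `Λ̄(J^c)` for some poset ideal
`J ⊆ Hom(P,ℕ)` (i.e. the monomials lying in `I` are exactly the `Λ̄ψ`, `ψ ∈ J^c`)
if and only if `I` is `P`-stable. -/
theorem pStable_iff_from_posetIdeal (k : Type*) [Field k] {P : Type*} [PartialOrder P]
    [Fintype P] (I : Ideal (MvPolynomial P k)) (hI : IsMonomialIdeal k I) :
    (∃ J : Set (P →o ℕ), IsPosetIdeal J ∧
      ∀ d : P →₀ ℕ, monomial d (1 : k) ∈ I ↔ ∃ ψ : P →o ℕ, ψ ∉ J ∧ ⇑d = lambdaBar ψ) ↔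
    PStable k I := by
  constructor
  · rintro ⟨J, hJ, hmem⟩ n B a hB hm h
    obtain ⟨ψ, hψ, heq⟩ := (hmem _).1 hm
    refine (hmem _).2 ⟨chainWeightHom (n + Finsupp.single a 1 : P →₀ ℕ), fun hJ' => hψ ?_,
      (lambdaBar_chainWeightHom _).symm⟩
    refine hJ _ hJ' ψ fun p => ?_
    rw [← chainWeight_lambdaBar ψ p, ← heq]
    exact chainWeight_le_of_exchange hB h p
  · intro hst
    refine ⟨{ψ | monomial (ascentExponent ψ) (1 : k) ∉ I},
      fun q hq q' hle hmem => hq (hst.mem_of_le hle hmem), fun d => ⟨fun hd => ?_, ?_⟩⟩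
    · refine ⟨chainWeightHom d, not_not.2 ?_, (lambdaBar_chainWeightHom _).symm⟩
      convert hd
      exact DFunLike.coe_injective (lambdaBar_chainWeightHom d)
    · rintro ⟨ψ, hψ, hd⟩
      convert not_not.1 hψ
      exact DFunLike.coe_injective hd
end

section
/- Let α : P → ℕ be an isotone map, with principal poset ideal J(α) = {ψ ∈ Hom(P,ℕ) : ψ ≤ α} and principal letterplace ideal L(α,P) = L(J(α),P). For i ∈ ℕ let I_i = α^{-1}([0,i]), a poset ideal of P. Then L(α,P) is generated by the monomials ∏_{j=0}^{i} x_{φ(j),j} over all i ∈ ℕ and all isotone maps φ : {0,1,…,i} → P with φ(i) ∈ I_i; moreover the minimal generators are exactly those monomials where in addition φ(j) ∉ I_j for all j < i. -/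
open MvPolynomial
open scoped Classical

/-- The letterplace ideal `L(J,P) ⊆ k[x_{P×ℕ}]`, generated by the squarefree monomials
`m_{Λψ}` for `ψ` in the complement filter `J^c`. -/
noncomputable def letterplaceIdeal (k : Type*) [Field k] {P : Type*} [PartialOrder P]
    [Fintype P] (J : Set (P →o ℕ)) : Ideal (MvPolynomial (P × ℕ) k) :=
  Ideal.span {f | ∃ ψ : P →o ℕ, ψ ∉ J ∧ f = ∏ t ∈ (ascent_finite ψ).toFinset, X t}

/-- The graph of a sequence `φ : {0,…,n-1} → P` as a finite subset of `P × ℕ`. -/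
noncomputable def seqGraph {P : Type*} {n : ℕ} (φ : Fin n → P) : Finset (P × ℕ) :=
  Finset.image (fun j : Fin n => (φ j, (j : ℕ))) Finset.univ

lemma mem_seqGraph {P : Type*} {n : ℕ} {φ : Fin n → P} {t : P × ℕ} :
    t ∈ seqGraph φ ↔ ∃ j : Fin n, (φ j, (j : ℕ)) = t := by
  simp [seqGraph]

lemma prod_X_eq_prod_seqGraph (k : Type*) [CommSemiring k] {P : Type*} {n : ℕ}
    (φ : Fin n → P) :
    ∏ j : Fin n, (X (φ j, (j : ℕ)) : MvPolynomial (P × ℕ) k) = ∏ t ∈ seqGraph φ, X t := by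
  rw [seqGraph, Finset.prod_image]
  intro a _ b _ h
  exact Fin.ext (Prod.ext_iff.mp h).2

/-- A squarefree monomial lies in an ideal generated by squarefree monomials iff it is divisible
by one of the generators. -/
lemma prod_X_mem_span_iff (k : Type*) [Field k] {σ : Type*} (S : Set (Finset σ))
    (T : Finset σ) :
    (∏ t ∈ T, (X t : MvPolynomial σ k)) ∈ Ideal.span ((fun A => ∏ t ∈ A, X t) '' S) ↔
      ∃ A ∈ S, A ⊆ T := by
  constructor
  · intro h
    by_contra! hS
    let e : MvPolynomial σ k →+* k := eval fun t => if t ∈ T then 1 else 0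
    have hle : Ideal.span ((fun A => ∏ t ∈ A, X t) '' S) ≤ RingHom.ker e := by
      rw [Ideal.span_le]
      rintro _ ⟨A, hA, rfl⟩
      obtain ⟨t, htA, htT⟩ := Finset.not_subset.mp (hS A hA)
      simp only [SetLike.mem_coe, RingHom.mem_ker, e, map_prod, eval_X]
      exact Finset.prod_eq_zero htA (if_neg htT)
    have h0 := hle h
    rw [RingHom.mem_ker] at h0
    simp only [e, map_prod, eval_X] at h0
    rw [Finset.prod_congr rfl fun t ht => if_pos ht, Finset.prod_const_one] at h0
    exact one_ne_zero h0
  · rintro ⟨A, hA, hAT⟩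
    exact Ideal.mem_of_dvd _ (Finset.prod_dvd_prod_of_subset A T _ hAT)
      (Ideal.subset_span ⟨A, hA, rfl⟩)

/-- If `i < ψ p`, the ascent of `ψ` contains the graph of an isotone `φ : {0,…,i} → P` ending
below `p`. -/
lemma exists_monotone_mem_ascent {P : Type*} [PartialOrder P] [Finite P] (ψ : P →o ℕ) (i : ℕ) :
    ∀ p, i < ψ p → ∃ φ : Fin (i + 1) → P, Monotone φ ∧ φ (Fin.last i) ≤ p ∧
      ∀ j, (φ j, (j : ℕ)) ∈ ascent ψ := by
  have exists_le (i : ℕ) (p : P) (hp : i < ψ p) : ∃ q ≤ p, (q, i) ∈ ascent ψ := by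
    obtain ⟨q, hqp, hq⟩ := exists_minimal_le_of_wellFoundedLT (fun q => i < ψ q) p hp
    exact ⟨q, hqp, hq.prop, fun r hr => not_lt.mp (hq.not_prop_of_lt hr)⟩
  induction i with
  | zero =>
    intro p hp
    obtain ⟨q, hqp, hq⟩ := exists_le 0 p hp
    exact ⟨fun _ => q, monotone_const, hqp, fun j => by simpa using hq⟩
  | succ i ih =>
    intro p hp
    obtain ⟨q, hqp, hq⟩ := exists_le (i + 1) p hp
    obtain ⟨φ, hφ, hlast, hasc⟩ := ih q ((Nat.lt_succ_self i).trans hq.1)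
    refine ⟨Fin.snoc (α := fun _ => P) φ q, ?_, by simpa using hqp, ?_⟩
    · intro a b
      induction b using Fin.lastCases with
      | last =>
        induction a using Fin.lastCases with
        | last => simp
        | cast a => simpa using fun _ => (hφ (Fin.le_last a)).trans hlast
      | cast b =>
        induction a using Fin.lastCases with
        | last => intro h; exact absurd h (Fin.castSucc_lt_last b).not_ge
        | cast a => simpa using fun h => hφ h
    · intro j
      induction j using Fin.lastCases with
      | last => simpa using hq
      | cast j => simpa using hasc j

/-- The graph of an isotone `φ : {0,…,n-1} → P` contains the ascent of the isotone map
`p ↦ #{j : φ j ≤ p}`. -/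
lemma exists_ascent_subset_seqGraph {P : Type*} [PartialOrder P] {n : ℕ} (φ : Fin n → P)
    (hφ : Monotone φ) :
    ∃ ψ : P →o ℕ, (∀ j : Fin n, (j : ℕ) < ψ (φ j)) ∧ ascent ψ ⊆ seqGraph φ := by
  let S (p : P) : Finset (Fin n) := Finset.univ.filter fun j => φ j ≤ p
  let ψ : P →o ℕ := ⟨fun p => (S p).card, fun p q hpq => Finset.card_le_card fun j hj => by
    simp only [S, Finset.mem_filter, Finset.mem_univ, true_and] at hj ⊢
    exact hj.trans hpq⟩
  have lt_iff (p : P) (j : Fin n) : (j : ℕ) < ψ p ↔ φ j ≤ p := by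
    constructor
    · intro h
      by_contra hj
      have hsub : S p ⊆ Finset.Iio j := fun l hl => by
        simp only [S, Finset.mem_filter, Finset.mem_univ, true_and] at hl
        exact Finset.mem_Iio.mpr (not_le.mp fun hjl => hj ((hφ hjl).trans hl))
      have := Finset.card_le_card hsub
      rw [Fin.card_Iio] at this
      exact absurd h this.not_gt
    · intro h
      have hsub : Finset.Iic j ⊆ S p := fun l hl => by
        simp only [S, Finset.mem_filter, Finset.mem_univ, true_and]
        exact (hφ (Finset.mem_Iic.mp hl)).trans h
      have := Finset.card_le_card hsub
      rw [Fin.card_Iic] at this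
      exact this
  refine ⟨ψ, fun j => (lt_iff _ j).mpr le_rfl, ?_⟩
  rintro ⟨p, j⟩ ⟨hj, hmin⟩
  have hjn : j < n := hj.trans_le ((Finset.card_le_univ (S p)).trans_eq (Fintype.card_fin n))
  have hle : φ ⟨j, hjn⟩ ≤ p := (lt_iff p ⟨j, hjn⟩).mp hj
  refine Finset.mem_coe.mpr (mem_seqGraph.mpr ⟨⟨j, hjn⟩, Prod.ext ?_ rfl⟩)
  by_contra hne
  exact absurd ((lt_iff _ ⟨j, hjn⟩).mpr le_rfl) (hmin _ (lt_of_le_of_ne hle hne)).not_gt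

/-- The graphs of the isotone `φ : {0,…,i} → P` with `α (φ i) ≤ i`. -/
def principalGraphs {P : Type*} [PartialOrder P] (α : P →o ℕ) : Set (Finset (P × ℕ)) :=
  {A | ∃ (i : ℕ) (φ : Fin (i + 1) → P), Monotone φ ∧ α (φ (Fin.last i)) ≤ i ∧ A = seqGraph φ}

lemma letterplaceIdeal_Iic_eq_span (k : Type*) [Field k] {P : Type*} [PartialOrder P]
    [Fintype P] (α : P →o ℕ) :
    letterplaceIdeal k {ψ : P →o ℕ | ψ ≤ α} =
      Ideal.span ((fun A => ∏ t ∈ A, (X t : MvPolynomial (P × ℕ) k)) '' principalGraphs α) := by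
  apply le_antisymm
  · refine Ideal.span_le.mpr ?_
    rintro _ ⟨ψ, hψ, rfl⟩
    obtain ⟨p, hp⟩ : ∃ p, α p < ψ p := by
      by_contra! h
      exact hψ h
    obtain ⟨φ, hφ, hlast, hasc⟩ := exists_monotone_mem_ascent ψ (α p) p hp
    refine (prod_X_mem_span_iff k _ _).mpr ⟨_, ⟨_, φ, hφ, α.monotone hlast, rfl⟩, ?_⟩
    intro t ht
    obtain ⟨j, rfl⟩ := mem_seqGraph.mp ht
    exact (ascent_finite ψ).mem_toFinset.mpr (hasc j)
  · refine Ideal.span_le.mpr ?_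
    rintro _ ⟨_, ⟨i, φ, hφ, hlast, rfl⟩, rfl⟩
    obtain ⟨ψ, hψ, hsub⟩ := exists_ascent_subset_seqGraph φ hφ
    refine Ideal.mem_of_dvd _ (Finset.prod_dvd_prod_of_subset (ascent_finite ψ).toFinset _ _ ?_)
      (Ideal.subset_span ⟨ψ, fun h => ?_, rfl⟩)
    · intro t ht
      exact hsub ((ascent_finite ψ).mem_toFinset.mp ht)
    · exact absurd ((h _).trans hlast) (hψ (Fin.last i)).not_ge

/-- **Generators of the principal letterplace ideal.** For an isotone `α : P → ℕ` with
principal poset ideal `J(α) = {ψ : ψ ≤ α}` and `I_i = α^{-1}([0,i])`, the principal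
letterplace ideal `L(α,P) = L(J(α),P)` is generated by the monomials
`∏_{j=0}^{i} x_{φ(j),j}` over isotone `φ : {0,…,i} → P` with `φ(i) ∈ I_i`; moreover
such a monomial is a minimal generator iff in addition `φ(j) ∉ I_j` for all `j < i`. -/
theorem principal_letterplace_generators (k : Type*) [Field k] {P : Type*}
    [PartialOrder P] [Fintype P] (α : P →o ℕ) :
    (letterplaceIdeal k {ψ : P →o ℕ | ψ ≤ α} =
      Ideal.span {f | ∃ (i : ℕ) (φ : Fin (i + 1) → P), Monotone φ ∧
        α (φ (Fin.last i)) ≤ i ∧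
        f = ∏ j : Fin (i + 1), (X (φ j, (j : ℕ)) : MvPolynomial (P × ℕ) k)}) ∧
    (∀ (i : ℕ) (φ : Fin (i + 1) → P), Monotone φ → α (φ (Fin.last i)) ≤ i →
      (((∏ j : Fin (i + 1), (X (φ j, (j : ℕ)) : MvPolynomial (P × ℕ) k)) ∈
          letterplaceIdeal k {ψ : P →o ℕ | ψ ≤ α} ∧
        ∀ T ⊂ Finset.image (fun j : Fin (i + 1) => (φ j, (j : ℕ))) Finset.univ,
          (∏ t ∈ T, (X t : MvPolynomial (P × ℕ) k)) ∉
            letterplaceIdeal k {ψ : P →o ℕ | ψ ≤ α}) ↔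
      (∀ j : Fin (i + 1), (j : ℕ) < i → (j : ℕ) < α (φ j)))) := by
  refine ⟨?_, ?_⟩
  · rw [letterplaceIdeal_Iic_eq_span]
    congr 1
    ext f
    constructor
    · rintro ⟨_, ⟨i, φ, hφ, hlast, rfl⟩, rfl⟩
      exact ⟨i, φ, hφ, hlast, (prod_X_eq_prod_seqGraph k φ).symm⟩
    · rintro ⟨i, φ, hφ, hlast, rfl⟩
      exact ⟨_, ⟨i, φ, hφ, hlast, rfl⟩, (prod_X_eq_prod_seqGraph k φ).symm⟩
  · intro i φ hφ hlast
    rw [letterplaceIdeal_Iic_eq_span, prod_X_eq_prod_seqGraph]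
    simp only [prod_X_mem_span_iff]
    constructor
    · rintro ⟨-, hmin⟩ j hj
      by_contra! hα
      have hji : (j : ℕ) + 1 ≤ i + 1 := by omega
      refine hmin (seqGraph (φ ∘ Fin.castLE hji)) ?_
        ⟨_, ⟨j, _, hφ.comp (Fin.strictMono_castLE hji).monotone, hα, rfl⟩, subset_rfl⟩
      refine (Finset.ssubset_iff_of_subset ?_).mpr
        ⟨(φ (Fin.last i), i), mem_seqGraph.mpr ⟨Fin.last i, rfl⟩, ?_⟩
      · intro t ht
        obtain ⟨l, rfl⟩ := mem_seqGraph.mp ht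
        exact mem_seqGraph.mpr ⟨Fin.castLE hji l, rfl⟩
      · intro ht
        obtain ⟨l, hl⟩ := mem_seqGraph.mp ht
        have hli : (l : ℕ) = i := congrArg Prod.snd hl
        have := l.isLt
        omega
    · intro h
      refine ⟨⟨_, ⟨i, φ, hφ, hlast, rfl⟩, subset_rfl⟩, ?_⟩
      rintro T hT ⟨_, ⟨m, χ, -, hχlast, rfl⟩, hsub⟩
      have agree (l : Fin (m + 1)) : ∃ j : Fin (i + 1), (j : ℕ) = l ∧ φ j = χ l := by
        obtain ⟨j, hj⟩ := mem_seqGraph.mp (hT.subset (hsub (mem_seqGraph.mpr ⟨l, rfl⟩)))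
        exact ⟨j, congrArg Prod.snd hj, congrArg Prod.fst hj⟩
      obtain ⟨j, hjm, hj⟩ := agree (Fin.last m)
      rw [Fin.val_last] at hjm
      rcases (Nat.lt_succ_iff.mp j.isLt).lt_or_eq with hji | hji
      · have := h j hji
        rw [hj] at this
        omega
      · obtain rfl : m = i := hjm.symm.trans hji
        refine hT.2 fun t ht => hsub ?_
        obtain ⟨l, rfl⟩ := mem_seqGraph.mp ht
        obtain ⟨l', hl', hφl⟩ := agree l
        obtain rfl : l' = l := Fin.ext hl'
        exact mem_seqGraph.mpr ⟨l', by rw [hφl]⟩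
end
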